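/- arXiv:2108.09086 — 3 statements merged into one kernel-verified Lean document; each statement's English description precedes it below -/
import Mathlib

section
/- For every n ≥ 1 and ϑ ∈ (0,1), the spectral norm of A_h^{−1} satisfies ‖A_h^{−1}‖₂ ≤ √(‖A_h^{−1}‖₁ ‖A_h^{−1}‖_∞) = (1/(2(h(ϑ−1)+1)))·√(2/h + 2 + (h²−1)(ϑ−1)). -/
open Matrix Real Filter

/-- tridiagonal Toeplitz matrix with diagonal `d` and off-diagonal `o` -/
def trid (N : ℕ) (d o : ℝ) : Matrix (Fin N) (Fin N) ℝ :=
  Matrix.of fun r c => if r = c then d else if r.1 + 1 = c.1 ∨ c.1 + 1 = r.1 then o else 0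

/-- the matrix `T_{n+1}`: the Toeplitz matrix generated by `2 - 2cos θ`
(diagonal entries 2, off-diagonal entries -1) -/
def T (N : ℕ) : Matrix (Fin N) (Fin N) ℝ := trid N 2 (-1)

/-- the grid spacing `h = 1/(n+1)` -/
noncomputable def h (n : ℕ) : ℝ := 1 / (n + 1)

/-- `S_{n+1} = h⁻² T_{n+1}` -/
noncomputable def S (n : ℕ) : Matrix (Fin (n+1)) (Fin (n+1)) ℝ := ((h n)^2)⁻¹ • T (n+1)

/-- the vector `v_h` with first component `ϑh²-2`, second `(1-ϑ)h²+1`, the rest `0` -/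
noncomputable def vh (n : ℕ) (ϑ : ℝ) : Fin (n+1) → ℝ :=
  fun i => if i.1 = 0 then ϑ * (h n)^2 - 2 else if i.1 = 1 then (1-ϑ) * (h n)^2 + 1 else 0

/-- the first standard basis vector `e₁` -/
def e1 (n : ℕ) : Fin (n+1) → ℝ := fun i => if i.1 = 0 then 1 else 0

/-- the Coco–Russo matrix `A_h = S_{n+1} + h⁻² e₁ v_hᵀ` -/
noncomputable def A (n : ℕ) (ϑ : ℝ) : Matrix (Fin (n+1)) (Fin (n+1)) ℝ :=
  S n + ((h n)^2)⁻¹ • Matrix.vecMulVec (e1 n) (vh n ϑ)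

/-- matrix norm induced by the vector ∞-norm: maximum absolute row sum -/
noncomputable def normInf {N : ℕ} (M : Matrix (Fin (N+1)) (Fin (N+1)) ℝ) : ℝ :=
  Finset.univ.sup' Finset.univ_nonempty (fun r => ∑ c, |M r c|)

/-- matrix norm induced by the vector 1-norm: maximum absolute column sum -/
noncomputable def norm1 {N : ℕ} (M : Matrix (Fin (N+1)) (Fin (N+1)) ℝ) : ℝ :=
  Finset.univ.sup' Finset.univ_nonempty (fun c => ∑ r, |M r c|)

/-- matrix norm induced by the Euclidean vector norm (the largest singular value) -/
noncomputable def norm2 {m : Type*} [Fintype m] [DecidableEq m] (M : Matrix m m ℝ) : ℝ :=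
  ‖Matrix.toEuclideanCLM (𝕜 := ℝ) M‖

/-- the Schur test -/
lemma schur {N : ℕ} (M : Matrix (Fin (N+1)) (Fin (N+1)) ℝ) :
    norm2 M ≤ Real.sqrt (norm1 M * normInf M) := by
  have hr : ∀ r, ∑ c, |M r c| ≤ normInf M := fun r =>
    Finset.le_sup' (fun r => ∑ c, |M r c|) (Finset.mem_univ r)
  have hc : ∀ c, ∑ r, |M r c| ≤ norm1 M := fun c =>
    Finset.le_sup' (fun c => ∑ r, |M r c|) (Finset.mem_univ c)
  have h0 : 0 ≤ normInf M := le_trans (Finset.sum_nonneg fun _ _ => abs_nonneg _) (hr 0)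
  have h1 : 0 ≤ norm1 M := le_trans (Finset.sum_nonneg fun _ _ => abs_nonneg _) (hc 0)
  unfold norm2
  refine ContinuousLinearMap.opNorm_le_bound _ (Real.sqrt_nonneg _) fun x => ?_
  rw [EuclideanSpace.norm_eq, EuclideanSpace.norm_eq, ← Real.sqrt_mul (mul_nonneg h1 h0)]
  apply Real.sqrt_le_sqrt
  simp only [Real.norm_eq_abs, sq_abs]
  have key : ∀ r, ((Matrix.toEuclideanCLM (𝕜 := ℝ) M) x r) ^ 2
      ≤ normInf M * ∑ c, |M r c| * x c ^ 2 := by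
    intro r
    have e : (Matrix.toEuclideanCLM (𝕜 := ℝ) M) x r = ∑ c, M r c * x c := by
      simp [Matrix.mulVec, dotProduct]
    rw [e]
    refine le_trans (Finset.sum_sq_le_sum_mul_sum_of_sq_le_mul Finset.univ
      (f := fun c => |M r c|) (g := fun c => |M r c| * x c ^ 2) ?_ ?_ ?_) ?_
    · intro i _; positivity
    · intro i _; positivity
    · intro i _
      apply le_of_eq; rw [mul_pow, ← sq_abs (M r i)]; ring
    · exact mul_le_mul_of_nonneg_right (hr r) (Finset.sum_nonneg fun _ _ => by positivity)
  calc _ ≤ ∑ r, normInf M * ∑ c, |M r c| * x c ^ 2 := Finset.sum_le_sum fun r _ => key r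
    _ = normInf M * ∑ c, (∑ r, |M r c|) * x c ^ 2 := by
        rw [← Finset.mul_sum, Finset.sum_comm]
        simp only [Finset.sum_mul]
    _ ≤ normInf M * ∑ c, norm1 M * x c ^ 2 := by
        gcongr with c; exact hc c
    _ = _ := by rw [← Finset.mul_sum]; ring

/-- entries of the inverse -/
noncomputable def gg (n : ℕ) (t : ℝ) (i j : ℕ) : ℝ :=
  if j = 0 then ((n:ℝ) + 1 - i) / (n + t)
  else if i ≤ j then (((n:ℝ) + 1)^2)⁻¹ * (n + 1 - j) * (i - 1 + t) / (n + t)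
  else (((n:ℝ) + 1)^2)⁻¹ * (j - 1 + t) * (n + 1 - i) / (n + t)

lemma A_row (n : ℕ) (hn : 1 ≤ n) (t : ℝ) (f : ℕ → ℝ) (hf : f (n+1) = 0) (r : Fin (n+1)) :
    ∑ c : Fin (n+1), A n t r c * f c.1 =
      if r.1 = 0 then t * f 0 + (1-t) * f 1
      else ((n:ℝ)+1)^2 * (2 * f r.1 - f (r.1-1) - f (r.1+1)) := by
  have hn0 : ((n:ℝ)+1) ≠ 0 := by positivity
  have hr := r.2
  by_cases h0 : r.1 = 0
  · have e : ∀ c : Fin (n+1), A n t r c * f c.1 =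
      (fun c : ℕ => (if c = 0 then t * f 0 else 0) + (if c = 1 then (1-t) * f 1 else 0)) c.1 := by
      intro c
      simp only [A, S, T, trid, h, vh, e1, Matrix.add_apply, Matrix.smul_apply, Matrix.of_apply,
        Matrix.vecMulVec_apply, smul_eq_mul, Fin.ext_iff, h0]
      rcases Nat.eq_zero_or_pos c.1 with hc | hc
      · simp [hc]; field_simp; left; ring
      · by_cases hc1 : c.1 = 1
        · simp [hc1]; field_simp; left; ring
        · have h1 : ¬ (0 = c.1) := by omega
          have h2 : ¬ (0 + 1 = c.1 ∨ c.1 + 1 = 0) := by omega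
          have h3 : ¬ (c.1 = 0) := by omega
          simp only [h1, h2, h3, hc1, if_false]; simp
    rw [Finset.sum_congr rfl fun c _ => e c, Fin.sum_univ_eq_sum_range (fun c : ℕ => (if c = 0 then t * f 0 else 0) + (if c = 1 then (1-t) * f 1 else 0)), Finset.sum_add_distrib, Finset.sum_ite_eq', Finset.sum_ite_eq']
    simp [h0]; omega
  · have e : ∀ c : Fin (n+1), A n t r c * f c.1 =
      (fun c : ℕ => ((if c = r.1 then ((n:ℝ)+1)^2 * (2 * f r.1) else 0) +
        (if c = r.1 - 1 then -(((n:ℝ)+1)^2 * f (r.1-1)) else 0)) +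
        (if c = r.1 + 1 then -(((n:ℝ)+1)^2 * f (r.1+1)) else 0)) c.1 := by
      intro c
      simp only [A, S, T, trid, h, vh, e1, Matrix.add_apply, Matrix.smul_apply, Matrix.of_apply,
        Matrix.vecMulVec_apply, smul_eq_mul, Fin.ext_iff, h0]
      by_cases ha : c.1 = r.1
      · have h1 : ¬ (r.1 = r.1 - 1) := by omega
        simp [ha, h1]; ring
      · have ha' : ¬ (r.1 = c.1) := fun h => ha h.symm
        by_cases hb : c.1 = r.1 - 1
        · have h1 : r.1 + 1 = c.1 ∨ c.1 + 1 = r.1 := by omega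
          have h2 : ¬ (c.1 = r.1 + 1) := by omega
          simp only [ha, ha', h1, h2, if_true, if_false]
          simp [hb]
        · by_cases hd : c.1 = r.1 + 1
          · simp [hd]
            omega
          · have h1 : ¬ (r.1 + 1 = c.1 ∨ c.1 + 1 = r.1) := by omega
            simp [ha, ha', hb, hd, h1]
    rw [Finset.sum_congr rfl fun c _ => e c, Fin.sum_univ_eq_sum_range (fun c : ℕ => ((if c = r.1 then ((n:ℝ)+1)^2 * (2 * f r.1) else 0) +
        (if c = r.1 - 1 then -(((n:ℝ)+1)^2 * f (r.1-1)) else 0)) +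
        (if c = r.1 + 1 then -(((n:ℝ)+1)^2 * f (r.1+1)) else 0)), Finset.sum_add_distrib,
        Finset.sum_add_distrib, Finset.sum_ite_eq', Finset.sum_ite_eq', Finset.sum_ite_eq']
    have m1 : r.1 ∈ Finset.range (n+1) := Finset.mem_range.mpr hr
    have m2 : r.1 - 1 ∈ Finset.range (n+1) := Finset.mem_range.mpr (by omega)
    simp only [m1, m2, h0, if_true, if_false]
    by_cases hl : r.1 + 1 ∈ Finset.range (n+1)
    · simp only [hl, if_true]; ring
    · have : r.1 + 1 = n + 1 := by simp at hl; omega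
      simp only [hl, if_false]; rw [this, hf]; ring

lemma A_inv (n : ℕ) (hn : 1 ≤ n) (t : ℝ) (ht : t ∈ Set.Ioo (0:ℝ) 1) :
    (A n t)⁻¹ = Matrix.of fun i j : Fin (n+1) => gg n t i.1 j.1 := by
  apply Matrix.inv_eq_right_inv
  ext r j
  have hn0 : ((n:ℝ)+1) ≠ 0 := by positivity
  have hD : (n:ℝ) + t ≠ 0 := by have := ht.1; positivity
  have hf : gg n t (n+1) j.1 = 0 := by
    have := j.2
    have h1 : ¬ (n + 1 ≤ j.1) := by omega
    unfold gg
    simp [h1]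
  rw [Matrix.mul_apply]
  simp only [Matrix.of_apply]
  rw [A_row n hn t (fun i => gg n t i j.1) hf r, Matrix.one_apply]
  simp only [Fin.ext_iff]
  by_cases h0 : r.1 = 0
  · by_cases hj : j.1 = 0
    · simp [h0, hj, gg]; field_simp; ring
    · have h1 : 1 ≤ j.1 := by omega
      have h2 : ¬ (0 = j.1) := by omega
      simp [h0, hj, gg, h1, h2]; field_simp; ring
  · obtain ⟨s, hs⟩ : ∃ s, r.1 = s + 1 := ⟨r.1 - 1, by omega⟩
    simp only [hs, Nat.add_sub_cancel]
    by_cases hj : j.1 = 0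
    · simp [hj, gg]; right; field_simp; ring
    · rcases lt_trichotomy (s+1) j.1 with hh | hh | hh
      · have h1 : s ≤ j.1 := by omega
        have h2 : s + 1 ≤ j.1 := by omega
        have h3 : s + 1 + 1 ≤ j.1 := by omega
        have h4 : ¬ (s + 1 = j.1) := by omega
        simp only [gg, hj, h1, h2, h3, h4, if_true, if_false, Nat.add_eq_zero_iff, one_ne_zero, and_false]
        push_cast; field_simp; ring
      · have h1 : s ≤ j.1 := by omega
        have h2 : s + 1 ≤ j.1 := by omega
        have h3 : ¬ (s + 1 + 1 ≤ j.1) := by omega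
        have h5 : (j.1:ℝ) = s + 1 := by rw [← hh]; push_cast; ring
        simp only [gg, hj, h1, h2, h3, if_true, if_false, Nat.add_eq_zero_iff, one_ne_zero, and_false]
        rw [if_pos hh, h5]
        push_cast; field_simp; ring
      · have h2 : ¬ (s + 1 ≤ j.1) := by omega
        have h3 : ¬ (s + 1 + 1 ≤ j.1) := by omega
        have h4 : ¬ (s + 1 = j.1) := by omega
        simp only [h4, if_false, Nat.add_eq_zero_iff, one_ne_zero, and_false]
        by_cases h1 : s ≤ j.1
        · have h5 : (j.1:ℝ) = s := by exact_mod_cast (by omega : j.1 = s)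
          simp only [gg, hj, h1, h2, h3, if_true, if_false]
          rw [h5]
          push_cast; field_simp; ring
        · simp only [gg, hj, h1, h2, h3, if_false]
          push_cast; field_simp; ring

lemma sum_lin (a : ℝ) (k : ℕ) : ∑ i ∈ Finset.range k, (a - i) = k * a - k * (k - 1) / 2 := by
  induction k with
  | zero => simp
  | succ k ih => rw [Finset.sum_range_succ, ih]; push_cast; ring

lemma gg_col (n : ℕ) (t : ℝ) (ht : t ∈ Set.Ioo (0:ℝ) 1) (i j : ℕ) (hi : i ≤ n) (hj : j ≤ n) :
    |gg n t i j| ≤ ((n:ℝ) + 1 - i) / (n + t) := by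
  obtain ⟨t0, t1⟩ := ht
  have hD : 0 < (n:ℝ) + t := by positivity
  have hi' : (i:ℝ) ≤ n := by exact_mod_cast hi
  have hj' : (j:ℝ) ≤ n := by exact_mod_cast hj
  have hi0 : (0:ℝ) ≤ i := by positivity
  have hn0 : (0:ℝ) ≤ n := by positivity
  have hm : (0:ℝ) < ((n:ℝ)+1)^2 := by positivity
  unfold gg
  rw [abs_le]
  by_cases j0 : j = 0
  · simp only [j0, if_true]
    have : 0 ≤ ((n:ℝ) + 1 - i) / (n + t) := div_nonneg (by linarith) hD.le
    constructor <;> linarith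
  have j1 : (1:ℝ) ≤ j := by exact_mod_cast Nat.one_le_iff_ne_zero.mpr j0
  simp only [j0, if_false]
  rw [← neg_div]
  split_ifs with hij
  · have hij' : (i:ℝ) ≤ j := by exact_mod_cast hij
    have a1 : ((n:ℝ) + 1 - j) * (i - 1 + t) ≤ (n+1)^2 * (n + 1 - i) := by
      have : ((n:ℝ) + 1 - j) * (i - 1 + t) ≤ (n + 1 - i) * (n+1)^2 := by
        have h1 : ((n:ℝ) + 1 - j) * (i - 1 + t) ≤ (n + 1 - j) * (n+1)^2 :=
          mul_le_mul_of_nonneg_left (by nlinarith) (by linarith)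
        have h2 : ((n:ℝ) + 1 - j) * (n+1)^2 ≤ (n + 1 - i) * (n+1)^2 :=
          mul_le_mul_of_nonneg_right (by linarith) hm.le
        linarith
      linarith
    have a2 : -(((n:ℝ)+1)^2 * (n + 1 - i)) ≤ ((n:ℝ) + 1 - j) * (i - 1 + t) := by
      have h1 : ((n:ℝ) + 1 - j) * (-1) ≤ (n + 1 - j) * (i - 1 + t) :=
          mul_le_mul_of_nonneg_left (by linarith) (by linarith)
      have h2 : ((n:ℝ)+1 - i) * 1 ≤ (n + 1 - i) * (n+1)^2 :=
          mul_le_mul_of_nonneg_left (by nlinarith) (by linarith)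
      nlinarith
    constructor
    · apply div_le_div_of_nonneg_right _ hD.le
      rw [mul_assoc, inv_mul_eq_div, le_div_iff₀ hm]; linarith
    · apply div_le_div_of_nonneg_right _ hD.le
      rw [mul_assoc, inv_mul_eq_div, div_le_iff₀ hm]; linarith
  · have a0 : 0 ≤ ((j:ℝ) - 1 + t) * (n + 1 - i) := mul_nonneg (by linarith) (by linarith)
    have a1 : ((j:ℝ) - 1 + t) * (n + 1 - i) ≤ (n+1)^2 * (n + 1 - i) :=
      mul_le_mul_of_nonneg_right (by nlinarith) (by linarith)
    constructor
    · apply div_le_div_of_nonneg_right _ hD.le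
      rw [mul_assoc, inv_mul_eq_div, le_div_iff₀ hm]; nlinarith
    · apply div_le_div_of_nonneg_right _ hD.le
      rw [mul_assoc, inv_mul_eq_div, div_le_iff₀ hm]; linarith

lemma gg_row (n : ℕ) (t : ℝ) (ht : t ∈ Set.Ioo (0:ℝ) 1) (i j : ℕ) (hi : i ≤ n) (hj : j ≤ n)
    (i0 : 1 ≤ i) (j0 : 1 ≤ j) :
    |gg n t i j| ≤ (i / (n+1)) / (n + t) := by
  obtain ⟨t0, t1⟩ := ht
  have hD : 0 < (n:ℝ) + t := by positivity
  have hi' : (i:ℝ) ≤ n := by exact_mod_cast hi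
  have hj' : (j:ℝ) ≤ n := by exact_mod_cast hj
  have i1 : (1:ℝ) ≤ i := by exact_mod_cast i0
  have j1 : (1:ℝ) ≤ j := by exact_mod_cast j0
  have hn0 : (0:ℝ) ≤ n := by positivity
  have hm : (0:ℝ) < ((n:ℝ)+1)^2 := by positivity
  have e : ((i:ℝ) / (n+1)) = (((n:ℝ)+1)^2)⁻¹ * (i * (n+1)) := by field_simp
  unfold gg
  have j2 : j ≠ 0 := by omega
  simp only [j2, if_false]
  rw [e]
  split_ifs with hij
  · have : (0:ℝ) ≤ i - 1 + t := by linarith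
    have : (0:ℝ) ≤ n + 1 - j := by linarith
    rw [abs_of_nonneg (by positivity), mul_assoc]
    refine div_le_div_of_nonneg_right (mul_le_mul_of_nonneg_left ?_ (by positivity)) hD.le
    rw [mul_comm]
    apply mul_le_mul <;> linarith
  · have hij' : (j:ℝ) ≤ i := by exact_mod_cast (by omega : j ≤ i)
    have : (0:ℝ) ≤ j - 1 + t := by linarith
    have : (0:ℝ) ≤ n + 1 - i := by linarith
    rw [abs_of_nonneg (by positivity), mul_assoc]
    refine div_le_div_of_nonneg_right (mul_le_mul_of_nonneg_left ?_ (by positivity)) hD.le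
    apply mul_le_mul <;> linarith

lemma norm1_eq (n : ℕ) (hn : 1 ≤ n) (t : ℝ) (ht : t ∈ Set.Ioo (0:ℝ) 1) :
    norm1 (A n t)⁻¹ = ((n:ℝ)+1) * (n+2) / 2 / (n + t) := by
  have hD : 0 < (n:ℝ) + t := by have := ht.1; positivity
  have e : ∑ i : Fin (n+1), (((n:ℝ) + 1 - (i.1:ℕ)) / (n + t)) = ((n:ℝ)+1) * (n+2) / 2 / (n + t) := by
    rw [← Finset.sum_div, Fin.sum_univ_eq_sum_range (fun i : ℕ => ((n:ℝ) + 1 - i)), sum_lin]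
    push_cast; congr 1; ring
  rw [A_inv n hn t ht, norm1, ← e]
  apply le_antisymm
  · refine Finset.sup'_le _ _ fun j _ => Finset.sum_le_sum fun i _ => ?_
    exact gg_col n t ht _ _ (by omega) (by omega)
  · refine le_trans ?_ (Finset.le_sup' _ (Finset.mem_univ (0 : Fin (n+1))))
    refine Finset.sum_le_sum fun i _ => ?_
    refine le_trans (le_of_eq ?_) (le_abs_self _)
    simp [gg]

lemma normInf_eq (n : ℕ) (hn : 1 ≤ n) (t : ℝ) (ht : t ∈ Set.Ioo (0:ℝ) 1) :
    normInf (A n t)⁻¹ = ((n:ℝ) + 1 + (1-t) * n / (2 * (n+1))) / (n + t) := by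
  have hD : 0 < (n:ℝ) + t := by have := ht.1; positivity
  have t1 : 0 < 1 - t := by linarith [ht.2]
  have r0 : ∑ c : Fin (n+1), |gg n t 0 c.1| = ((n:ℝ) + 1 + (1-t) * n / (2 * (n+1))) / (n + t) := by
    rw [Fin.sum_univ_succ]
    have a : ∀ c : Fin n, |gg n t 0 (c.succ).1| =
        (fun c : ℕ => (((n:ℝ)+1)^2)⁻¹ * (1-t) / (n+t) * ((n:ℝ) - c)) c.1 := by
      intro c
      have : (c.1:ℝ) ≤ n := by exact_mod_cast c.2.le
      have h2 : 0 ≤ (((n:ℝ)+1)^2)⁻¹ * (1-t) / (n+t) * ((n:ℝ) - c) :=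
        mul_nonneg (by positivity) (by linarith)
      beta_reduce
      rw [← abs_of_nonneg h2, ← abs_neg]
      congr 1
      simp only [gg, Fin.val_succ, Nat.add_eq_zero_iff, one_ne_zero, and_false, if_false,
        Nat.zero_le, if_true]
      push_cast
      ring
    rw [Finset.sum_congr rfl fun c _ => a c,
      Fin.sum_univ_eq_sum_range (fun c : ℕ => (((n:ℝ)+1)^2)⁻¹ * (1-t) / (n+t) * ((n:ℝ) - c)),
      ← Finset.mul_sum, sum_lin]
    have b : |gg n t 0 (0 : Fin (n+1)).1| = ((n:ℝ)+1) / (n+t) := by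
      rw [abs_of_nonneg] <;> simp [gg]
      positivity
    rw [b]
    field_simp
    ring
  rw [A_inv n hn t ht, normInf]
  apply le_antisymm
  · refine Finset.sup'_le _ _ fun i _ => ?_
    simp only [Matrix.of_apply]
    rcases Nat.eq_zero_or_pos i.1 with h0 | h0
    · rw [h0, r0]
    · rw [Fin.sum_univ_succ]
      have b : |gg n t i.1 (0 : Fin (n+1)).1| ≤ ((n:ℝ)+1 - i.1) / (n+t) :=
        gg_col n t ht _ _ (by omega) (by simp)
      have s : ∑ c : Fin n, |gg n t i.1 (c.succ).1| ≤ ∑ c : Fin n, ((i.1:ℝ) / (n+1)) / (n + t) :=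
        Finset.sum_le_sum fun c _ => gg_row n t ht _ _ (by omega) (by simp) h0 (by simp)
      have s2 : ∑ c : Fin n, ((i.1:ℝ) / (n+1)) / (n + t) ≤ i.1 / (n+t) := by
        simp only [Finset.sum_const, Finset.card_univ, Fintype.card_fin, nsmul_eq_mul]
        rw [← mul_div_assoc]
        gcongr ?_ / _
        rw [← mul_div_assoc, div_le_iff₀ (by positivity)]
        have : (0:ℝ) ≤ i.1 := by positivity
        nlinarith
      have s3 : ((n:ℝ)+1 - i.1) / (n+t) + i.1 / (n+t) ≤ ((n:ℝ) + 1 + (1-t) * n / (2 * (n+1))) / (n + t) := by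
        rw [← add_div]
        gcongr ?_ / _
        have : 0 ≤ (1-t) * n / (2 * ((n:ℝ)+1)) := by positivity
        linarith
      linarith
  · rw [← r0]
    exact Finset.le_sup' (fun r : Fin (n+1) => ∑ c : Fin (n+1), |(Matrix.of fun i j : Fin (n+1) => gg n t i.1 j.1) r c|)
      (Finset.mem_univ (0 : Fin (n+1)))

/-- `‖A_h⁻¹‖₂ ≤ √(‖A_h⁻¹‖₁‖A_h⁻¹‖_∞) = (1/(2(h(ϑ−1)+1)))√(2/h + 2 + (h²−1)(ϑ−1))`. -/
theorem stmt_13 (n : ℕ) (hn : 1 ≤ n) (ϑ : ℝ) (hϑ : ϑ ∈ Set.Ioo (0:ℝ) 1) :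
    norm2 (A n ϑ)⁻¹ ≤ Real.sqrt (norm1 (A n ϑ)⁻¹ * normInf (A n ϑ)⁻¹) ∧
    Real.sqrt (norm1 (A n ϑ)⁻¹ * normInf (A n ϑ)⁻¹)
      = (1 / (2 * (h n * (ϑ - 1) + 1)))
          * Real.sqrt (2 / h n + 2 + ((h n)^2 - 1) * (ϑ - 1)) := by
  refine ⟨schur _, ?_⟩
  rw [norm1_eq n hn ϑ hϑ, normInf_eq n hn ϑ hϑ]
  have hD : 0 < (n:ℝ) + ϑ := by have := hϑ.1; positivity
  have q : h n * (ϑ - 1) + 1 = (n + ϑ) / (n + 1) := by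
    unfold h; field_simp; ring
  rw [q]
  have hq : 0 ≤ 1 / (2 * (((n:ℝ) + ϑ) / (n + 1))) := by positivity
  rw [← Real.sqrt_sq hq]
  rw [← Real.sqrt_mul (sq_nonneg _)]
  congr 1
  unfold h
  field_simp
  ring
end

section
/- (Spectral distribution in 1D.) Fix ϑ ∈ (0,1) and for each n ≥ 1 let A_h be the (n+1)×(n+1) Coco–Russo matrix with h = 1/(n+1). Then {h² A_h} ∼_λ 2 − 2cos θ; that is, for every continuous compactly supported function F : ℂ → ℂ, lim_{n→∞} (1/(n+1)) Σ_{i=1}^{n+1} F(λ_i(h² A_h)) = (1/(2π)) ∫_{−π}^{π} F(2 − 2cos θ) dθ, where λ_1(h²A_h),…,λ_{n+1}(h²A_h) are the eigenvalues of h²A_h counted with multiplicity. -/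
open Matrix Real Filter

/-- the eigenvalues of a real square matrix, counted with multiplicity:
the multiset of complex roots of its characteristic polynomial -/
noncomputable def eigs {m : Type*} [Fintype m] [DecidableEq m] (M : Matrix m m ℝ) :
    Multiset ℂ :=
  ((M.map (algebraMap ℝ ℂ)).charpoly).roots

lemma aux_row0 (n : ℕ) (hn : 2 ≤ n) (a b : ℝ) (v : ℕ → ℝ) :
    ∑ j ∈ Finset.range (n+1), (if j = 0 then a else if j = 1 then b else 0) * v j
      = a * v 0 + b * v 1 := by
  obtain ⟨m, rfl⟩ : ∃ m, n = m + 1 := ⟨n - 1, by omega⟩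
  rw [Finset.sum_range_succ', Finset.sum_range_succ']
  simp
  ring

lemma aux_row (n k : ℕ) (hk : k + 1 ≤ n) (v : ℕ → ℝ) (hv : v (n+1) = 0) :
    ∑ j ∈ Finset.range (n+1),
      (if k + 1 = j then 2 else if k + 1 + 1 = j ∨ j + 1 = k + 1 then (-1) else 0) * v j
      = 2 * v (k+1) - v k - v (k+2) := by
  have e : ∀ j, (if k + 1 = j then (2:ℝ) else if k + 1 + 1 = j ∨ j + 1 = k + 1 then (-1) else 0) * v j
      = (if k + 1 = j then 2 * v j else 0) - (if k = j then v j else 0)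
        - (if k + 2 = j then v j else 0) := by
    intro j
    split_ifs <;> first | omega | ring
  have := Finset.sum_range_succ (fun j => (if k + 1 = j then 2 else if k + 1 + 1 = j ∨ j + 1 = k + 1 then (-1) else 0) * v j) (n+1)
  simp only [hv, mul_zero, add_zero] at this
  rw [← this]
  simp only [e, Finset.sum_sub_distrib, Finset.sum_ite_eq, Finset.mem_range]
  rw [if_pos (by omega), if_pos (by omega), if_pos (by omega)]

lemma eigvec (n : ℕ) (hn : 2 ≤ n) (ϑ t : ℝ) (ht : Real.sin t ≠ 0)
    (hg : (2 - 2 * Real.cos t - ϑ * (h n)^2) * Real.sin ((n+1) * t)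
      - (1-ϑ) * (h n)^2 * Real.sin (n * t) = 0) :
    (((2:ℝ) - 2 * Real.cos t : ℝ) : ℂ) ∈ eigs ((h n)^2 • A n ϑ) := by
  have hh : (h n)^2 ≠ 0 := by unfold h; positivity
  set M := (h n)^2 • A n ϑ with hM
  have hM' : M = T (n+1) + Matrix.vecMulVec (e1 n) (vh n ϑ) := by
    rw [hM, A, S, ← smul_add, smul_smul, mul_inv_cancel₀ hh, one_smul]
  set l : ℝ := 2 - 2 * Real.cos t with hl
  have hdet : (Matrix.scalar (Fin (n+1)) l - M).det = 0 := by
    rw [← Matrix.exists_mulVec_eq_zero_iff]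
    let v : ℕ → ℝ := fun j => Real.sin ((n + 1 - (j:ℝ)) * t)
    refine ⟨fun j => v j.1, ?_, ?_⟩
    · intro h0
      have := congrFun h0 (Fin.last n)
      simp [v] at this
      exact ht this
    · have hrec : ∀ x : ℝ, Real.sin ((x+1)*t) + Real.sin ((x-1)*t)
          = 2 * Real.cos t * Real.sin (x*t) := by
        intro x
        rw [show (x+1)*t = x*t+t by ring, show (x-1)*t = x*t - t by ring, Real.sin_add,
          Real.sin_sub]; ring
      ext i
      rw [Matrix.sub_mulVec, Pi.sub_apply]
      have h1 : (Matrix.scalar (Fin (n+1)) l *ᵥ fun j : Fin (n+1) => v j.1) i = l * v i.1 := by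
        simp [Matrix.scalar_apply, Matrix.mulVec_diagonal]
      rw [h1, hM']
      simp only [Matrix.mulVec, dotProduct, Pi.zero_apply]
      obtain ⟨i, hi⟩ := i
      rcases i with _ | k
      · have : ∀ j : Fin (n+1), (T (n+1) + Matrix.vecMulVec (e1 n) (vh n ϑ)) ⟨0, hi⟩ j * v j.1
            = (fun j : ℕ => (if j = 0 then ϑ * (h n)^2 else if j = 1 then (1-ϑ) * (h n)^2 else 0) * v j) j.1 := by
          rintro ⟨j, hj⟩
          simp only [Matrix.add_apply, T, trid, Matrix.of_apply, Matrix.vecMulVec_apply, e1, vh,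
            Fin.mk.injEq]
          congr 1
          have hsp : j = 0 ∨ j = 1 ∨ 2 ≤ j := by omega
          rcases hsp with rfl | rfl | hj2
          · simp
          · simp
          · have q1 : j ≠ 0 := by omega
            have q2 : j ≠ 1 := by omega
            simp [q1, q2, q1.symm, q2.symm]
        rw [Finset.sum_congr rfl (fun j _ => this j), Fin.sum_univ_eq_sum_range (fun j : ℕ => (if j = 0 then ϑ * (h n)^2 else if j = 1 then (1-ϑ) * (h n)^2 else 0) * v j) (n+1), aux_row0 n hn]
        simp only [v, Nat.cast_zero, Nat.cast_one, sub_zero, add_sub_cancel_right]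
        linarith
      · have : ∀ j : Fin (n+1), (T (n+1) + Matrix.vecMulVec (e1 n) (vh n ϑ)) ⟨k+1, hi⟩ j * v j.1
            = (fun j : ℕ => (if k + 1 = j then 2 else if k + 1 + 1 = j ∨ j + 1 = k + 1 then (-1) else 0) * v j) j.1 := by
          rintro ⟨j, hj⟩
          simp only [Matrix.add_apply, T, trid, Matrix.of_apply, Matrix.vecMulVec_apply, e1, vh,
            Fin.mk.injEq]
          congr 1
          simp
        rw [Finset.sum_congr rfl (fun j _ => this j), Fin.sum_univ_eq_sum_range (fun j : ℕ => (if k + 1 = j then 2 else if k + 1 + 1 = j ∨ j + 1 = k + 1 then (-1) else 0) * v j) (n+1),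
          aux_row n k (by omega) v (by simp [v])]
        have := hrec (n + 1 - ((k+1 : ℕ):ℝ))
        simp only [v]
        have e1 : (n + 1 - ((k+1 : ℕ):ℝ)) + 1 = n + 1 - (k:ℝ) := by push_cast; ring
        have e2 : (n + 1 - ((k+1 : ℕ):ℝ)) - 1 = n + 1 - ((k+2 : ℕ):ℝ) := by push_cast; ring
        rw [e1, e2] at this
        rw [hl]
        linarith
  rw [eigs, Polynomial.mem_roots (Matrix.charpoly_monic _).ne_zero, Matrix.charpoly_map]
  have : (M.charpoly).IsRoot l := by
    rw [Polynomial.IsRoot, Matrix.eval_charpoly, hdet]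
  exact this.map (f := algebraMap ℝ ℂ)

lemma exists_theta (n : ℕ) (ϑ : ℝ) (hϑ : ϑ ∈ Set.Ioo (0:ℝ) 1) (k : ℕ)
    (hk : k ∈ Finset.Ico 1 n) :
    ∃ t ∈ Set.Ioo (k * (π / (n+1))) ((k+1) * (π / (n+1))),
      (2 - 2 * Real.cos t - ϑ * (h n)^2) * Real.sin ((n+1) * t)
      - (1-ϑ) * (h n)^2 * Real.sin (n * t) = 0 := by
  rw [Finset.mem_Ico] at hk
  set c : ℝ := π / (n+1) with hc
  have hn0 : (0:ℝ) < n + 1 := by positivity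
  have hc0 : 0 < c := by positivity
  have hnc : (n+1) * c = π := by rw [hc]; field_simp
  have hh : 0 < (h n)^2 := by unfold h; positivity
  set g : ℝ → ℝ := fun t => (2 - 2 * Real.cos t - ϑ * (h n)^2) * Real.sin ((n+1) * t)
      - (1-ϑ) * (h n)^2 * Real.sin (n * t) with hg
  have hgc : Continuous g := by fun_prop
  have key : ∀ m : ℕ, g (m * c) = (-1)^m * ((1-ϑ) * (h n)^2 * Real.sin (m * c)) := by
    intro m
    have a1 : (n+1) * (m * c) = m * π := by rw [← hnc]; ring
    have a2 : n * (m * c) = m * π - m * c := by rw [← a1]; ring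
    simp only [hg]
    rw [a1, a2, Real.sin_nat_mul_pi, Real.sin_sub, Real.sin_nat_mul_pi, Real.cos_nat_mul_pi]
    ring
  have pos : ∀ m : ℕ, 1 ≤ m → m ≤ n → 0 < (1-ϑ) * (h n)^2 * Real.sin (m * c) := by
    intro m h1 h2
    have : 0 < Real.sin (m * c) := by
      apply Real.sin_pos_of_pos_of_lt_pi
      · have : (0:ℝ) < m := by exact_mod_cast h1
        positivity
      · rw [← hnc]
        have : (m:ℝ) ≤ n := by exact_mod_cast h2
        nlinarith
    have := hϑ.2
    have : 0 < 1 - ϑ := by linarith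
    positivity
  have p1 := pos k hk.1 hk.2.le
  have p2 := pos (k+1) (by omega) hk.2
  have k1 := key k
  have k2 := key (k+1)
  push_cast at k2 p2
  have hle : (k:ℝ) * c ≤ (k+1) * c := by nlinarith
  rcases neg_one_pow_eq_or ℝ k with e | e
  · rw [e] at k1
    rw [pow_succ, e] at k2
    obtain ⟨t, ht, h0⟩ := intermediate_value_Ioo' hle hgc.continuousOn
      (show (0:ℝ) ∈ Set.Ioo _ _ from ⟨by linarith, by linarith⟩)
    exact ⟨t, ht, h0⟩
  · rw [e] at k1
    rw [pow_succ, e] at k2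
    obtain ⟨t, ht, h0⟩ := intermediate_value_Ioo hle hgc.continuousOn
      (show (0:ℝ) ∈ Set.Ioo _ _ from ⟨by linarith, by linarith⟩)
    exact ⟨t, ht, h0⟩

lemma main_n (n : ℕ) (hn : 2 ≤ n) (ϑ : ℝ) (hϑ : ϑ ∈ Set.Ioo (0:ℝ) 1)
    (F : ℂ → ℂ) (C : ℝ) (hC : ∀ z, ‖F z‖ ≤ C) :
    ∃ t : ℕ → ℝ, (∀ k : ℕ, t k ∈ Set.Icc (k * (π / (n+1))) ((k+1) * (π / (n+1)))) ∧
      ‖((eigs ((h n)^2 • A n ϑ)).map F).sum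
        - ∑ k ∈ Finset.range (n+1), F ((2:ℝ) - 2 * Real.cos (t k))‖ ≤ 4 * C := by
  classical
  have hc0 : 0 < π / ((n:ℝ)+1) := by positivity
  have hnc : (n+1) * (π / ((n:ℝ)+1)) = π := by field_simp
  have ex : ∀ k : ℕ, ∃ t ∈ Set.Icc (k * (π / ((n:ℝ)+1))) ((k+1) * (π / (n+1))),
      k ∈ Finset.Ico 1 n → (t ∈ Set.Ioo (k * (π / (n+1))) ((k+1) * (π / (n+1))) ∧
      (2 - 2 * Real.cos t - ϑ * (h n)^2) * Real.sin ((n+1) * t)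
      - (1-ϑ) * (h n)^2 * Real.sin (n * t) = 0) := by
    intro k
    by_cases hk : k ∈ Finset.Ico 1 n
    · obtain ⟨t, h1, h2⟩ := exists_theta n ϑ hϑ k hk
      exact ⟨t, Set.Ioo_subset_Icc_self h1, fun _ => ⟨h1, h2⟩⟩
    · exact ⟨k * (π / ((n:ℝ)+1)), ⟨le_rfl, by nlinarith⟩, fun h => absurd h hk⟩
  choose t ht1 ht2 using ex
  refine ⟨t, ht1, ?_⟩
  set c := π / ((n:ℝ)+1)
  have hrange : ∀ k ∈ Finset.Ico 1 n, t k ∈ Set.Ioo 0 π := by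
    intro k hk
    have := (ht2 k hk).1
    rw [Finset.mem_Ico] at hk
    have h2 : (k:ℝ) + 1 ≤ n := by exact_mod_cast hk.2
    refine ⟨lt_of_le_of_lt (by positivity) this.1, this.2.trans_le ?_⟩
    rw [← hnc]
    nlinarith
  have hmono : ∀ j ∈ Finset.Ico 1 n, ∀ k ∈ Finset.Ico 1 n, j < k → t j < t k := by
    intro j hj k hk hjk
    have h1 := (ht2 j hj).1.2
    have h2 := (ht2 k hk).1.1
    have h3 : (j:ℝ) + 1 ≤ k := by exact_mod_cast hjk
    nlinarith
  let φ : ℕ → ℂ := fun k => (((2:ℝ) - 2 * Real.cos (t k) : ℝ) : ℂ)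
  have hinj : Set.InjOn φ (Finset.Ico 1 n : Finset ℕ) := by
    intro j hj k hk hjk
    have h1 : Real.cos (t j) = Real.cos (t k) := by
      have : (2:ℝ) - 2 * Real.cos (t j) = 2 - 2 * Real.cos (t k) := Complex.ofReal_injective hjk
      linarith
    have h2 := Real.injOn_cos (Set.Ioo_subset_Icc_self (hrange j hj))
      (Set.Ioo_subset_Icc_self (hrange k hk)) h1
    rcases lt_trichotomy j k with h | h | h
    · exact absurd h2 (hmono j hj k hk h).ne
    · exact h
    · exact absurd h2 (hmono k hk j hj h).ne'
  have hle : ((Finset.Ico 1 n).image φ).val ≤ eigs ((h n)^2 • A n ϑ) := by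
    rw [Multiset.le_iff_subset (Finset.nodup _)]
    intro z hz
    rw [Finset.mem_val, Finset.mem_image] at hz
    obtain ⟨k, hk, rfl⟩ := hz
    exact eigvec n hn ϑ (t k) (Real.sin_pos_of_mem_Ioo (hrange k hk)).ne' (ht2 k hk).2
  obtain ⟨s, hs⟩ := Multiset.le_iff_exists_add.1 hle
  have hcard : Multiset.card (eigs ((h n)^2 • A n ϑ)) = n + 1 := by
    rw [eigs, ← (IsAlgClosed.splits _).natDegree_eq_card_roots, Matrix.charpoly_natDegree_eq_dim]
    simp
  have hs2 : Multiset.card s = 2 := by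
    rw [hs, Multiset.card_add, Finset.card_val, Finset.card_image_of_injOn hinj,
      Nat.card_Ico] at hcard
    omega
  obtain ⟨x, y, rfl⟩ := Multiset.card_eq_two.1 hs2
  have hsum : ((eigs ((h n)^2 • A n ϑ)).map F).sum
      = ∑ k ∈ Finset.Ico 1 n, F (φ k) + (F x + F y) := by
    rw [hs, Multiset.map_add, Multiset.sum_add]
    congr 1
    · exact Finset.sum_image (f := F) hinj
    · simp
  have hr : ∑ k ∈ Finset.range (n+1), F ((2:ℝ) - 2 * Real.cos (t k))
      = F (φ 0) + ∑ k ∈ Finset.Ico 1 n, F (φ k) + F (φ n) := by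
    have : ∀ k, F ((2:ℝ) - 2 * Real.cos (t k)) = F (φ k) := by
      intro k; simp [φ]
    simp only [this]
    rw [Finset.sum_range_succ, Finset.range_eq_Ico, Finset.sum_eq_sum_Ico_succ_bot (by omega)]
  rw [hsum, hr]
  have : ∑ k ∈ Finset.Ico 1 n, F (φ k) + (F x + F y)
      - (F (φ 0) + ∑ k ∈ Finset.Ico 1 n, F (φ k) + F (φ n))
      = (F x + F y) - (F (φ 0) + F (φ n)) := by ring
  rw [this]
  refine (norm_sub_le _ _).trans ?_
  have a1 := norm_add_le (F x) (F y)
  have a2 := norm_add_le (F (φ 0)) (F (φ n))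
  linarith [hC x, hC y, hC (φ 0), hC (φ n)]

lemma riemann (G : ℝ → ℂ) (hG : Continuous G) (ε : ℝ) (hε : 0 < ε) :
    ∀ᶠ n : ℕ in atTop, ∀ t : ℕ → ℝ,
      (∀ k : ℕ, t k ∈ Set.Icc (k * (π / ((n:ℝ)+1))) ((k+1) * (π / (n+1)))) →
      ‖(π / ((n:ℝ)+1) : ℝ) * ∑ k ∈ Finset.range (n+1), G (t k) - ∫ θ in (0:ℝ)..π, G θ‖ ≤ ε := by
  have hu := isCompact_Icc.uniformContinuousOn_of_continuous (hG.continuousOn (s := Set.Icc 0 π))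
  rw [Metric.uniformContinuousOn_iff] at hu
  obtain ⟨δ, hδ, hu⟩ := hu (ε / π) (by positivity)
  have hlim : Tendsto (fun n : ℕ => π / ((n:ℝ)+1)) atTop (nhds 0) := by
    have := (tendsto_one_div_add_atTop_nhds_zero_nat (𝕜 := ℝ)).const_mul π
    simpa [div_eq_mul_inv] using this
  filter_upwards [hlim.eventually (gt_mem_nhds hδ)] with n hn t ht
  set c := π / ((n:ℝ)+1) with hc
  have hc0 : 0 < c := by positivity
  have hnc : (n+1) * c = π := by rw [hc]; field_simp
  have hint : ∫ θ in (0:ℝ)..π, G θ = ∑ k ∈ Finset.range (n+1),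
      ∫ θ in ((k:ℝ) * c)..(((k+1 : ℕ):ℝ) * c), G θ := by
    rw [intervalIntegral.sum_integral_adjacent_intervals (a := fun k : ℕ => (k:ℝ) * c)
      (fun k _ => hG.intervalIntegrable _ _)]
    push_cast
    rw [hnc, zero_mul]
  rw [hint, Finset.mul_sum, ← Finset.sum_sub_distrib]
  refine (norm_sum_le _ _).trans ?_
  have hb : ∀ k ∈ Finset.range (n+1), ‖(c:ℂ) * G (t k) -
      ∫ θ in ((k:ℝ) * c)..(((k+1 : ℕ):ℝ) * c), G θ‖ ≤ ε / π * c := by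
    intro k hk
    have hk' : (k:ℝ) + 1 ≤ n + 1 := by exact_mod_cast Finset.mem_range.1 hk
    have e : (c:ℂ) * G (t k) = ∫ θ in ((k:ℝ) * c)..(((k+1 : ℕ):ℝ) * c), G (t k) := by
      rw [intervalIntegral.integral_const]
      push_cast
      rw [show ((k:ℝ)+1) * c - k * c = c by ring]
      simp
    rw [e, ← intervalIntegral.integral_sub (intervalIntegrable_const)
      (hG.intervalIntegrable _ _)]
    have hle : (k:ℝ) * c ≤ ((k+1 : ℕ):ℝ) * c := by push_cast; nlinarith
    have := intervalIntegral.norm_integral_le_of_norm_le_const (a := (k:ℝ) * c)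
      (b := ((k+1 : ℕ):ℝ) * c) (f := fun θ => G (t k) - G θ) (C := ε / π) (by
        intro θ hθ
        rw [Set.uIoc_of_le hle] at hθ
        push_cast at hθ
        have h1 := ht k
        have hk0 : 0 ≤ (k:ℝ) * c := by positivity
        have hk1 : ((k:ℝ) + 1) * c ≤ π := by rw [← hnc]; nlinarith
        rw [← dist_eq_norm]
        refine (hu _ ⟨by linarith [h1.1], by linarith [h1.2]⟩ _
          ⟨by linarith [hθ.1], by linarith [hθ.2]⟩ ?_).le
        rw [Real.dist_eq, abs_lt]
        constructor <;> nlinarith [h1.1, h1.2, hθ.1, hθ.2])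
    refine this.trans_eq ?_
    push_cast
    rw [show ((k:ℝ)+1) * c - k * c = c by ring, abs_of_pos hc0]
  refine (Finset.sum_le_sum hb).trans_eq ?_
  rw [Finset.sum_const, Finset.card_range, nsmul_eq_mul]
  push_cast
  rw [show ((n:ℝ)+1) * (ε / π * c) = ε / π * ((n+1) * c) by ring, hnc]
  field_simp

/-- spectral distribution in 1D: `{h²A_h} ∼_λ 2−2cosθ`, i.e. for every continuous
compactly supported `F : ℂ → ℂ`,
`(1/(n+1)) Σᵢ F(λᵢ(h²A_h)) → (1/2π) ∫_{−π}^{π} F(2−2cosθ) dθ` as `n → ∞`. -/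
theorem stmt_16 (ϑ : ℝ) (hϑ : ϑ ∈ Set.Ioo (0:ℝ) 1)
    (F : ℂ → ℂ) (hF : Continuous F) (hFc : HasCompactSupport F) :
    Tendsto
      (fun n : ℕ => (1 / ((n:ℂ)+1)) * ((eigs ((h n)^2 • A n ϑ)).map F).sum)
      atTop
      (nhds ((1 / (2*(π:ℂ))) * ∫ θ in (-π)..π, F ((2:ℝ) - 2 * Real.cos θ))) := by
  obtain ⟨C, hC⟩ := hF.bounded_above_of_compact_support hFc
  set G : ℝ → ℂ := fun θ => F ((2:ℝ) - 2 * Real.cos θ) with hGdef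
  have hG : Continuous G := by
    have : Continuous fun θ : ℝ => (((2:ℝ):ℂ) - 2 * ((Real.cos θ : ℝ) : ℂ)) := by fun_prop
    exact hF.comp this
  have heven : ∫ θ in (-π)..π, G θ = 2 * ∫ θ in (0:ℝ)..π, G θ := by
    rw [← intervalIntegral.integral_add_adjacent_intervals (b := 0)
      (hG.intervalIntegrable _ _) (hG.intervalIntegrable _ _)]
    have := intervalIntegral.integral_comp_neg (a := 0) (b := π) (fun θ => G θ)
    have e : ∀ θ, G (-θ) = G θ := by intro θ; simp [G]
    simp only [e, neg_zero] at this
    rw [← this]; ring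
  have hpi : (π:ℂ) ≠ 0 := by exact_mod_cast Real.pi_ne_zero
  have hC0 : 0 ≤ C := (norm_nonneg _).trans (hC 0)
  change Tendsto _ _ (nhds ((1 / (2*(π:ℂ))) * ∫ θ in (-π)..π, G θ))
  rw [heven, Metric.tendsto_atTop']
  intro ε hε
  have hlim : Tendsto (fun n : ℕ => 4 * C * (1 / ((n:ℝ)+1))) atTop (nhds 0) := by
    have := (tendsto_one_div_add_atTop_nhds_zero_nat (𝕜 := ℝ)).const_mul (4 * C)
    simpa using this
  have hev := ((riemann G hG (ε * π / 2) (by positivity)).and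
    (hlim.eventually (gt_mem_nhds (half_pos hε)))).and (eventually_ge_atTop 2)
  obtain ⟨N, hN⟩ := eventually_atTop.1 hev
  refine ⟨N, fun n hn => ?_⟩
  obtain ⟨⟨h1, h2⟩, h3⟩ := hN n hn.le
  obtain ⟨t, ht, hd⟩ := main_n n h3 ϑ hϑ F C hC
  have h4 := h1 t ht
  change ‖_ - ∑ k ∈ Finset.range (n+1), G (t k)‖ ≤ _ at hd
  set E := ((eigs ((h n)^2 • A n ϑ)).map F).sum
  set Q := ∑ k ∈ Finset.range (n+1), G (t k)
  set I := ∫ θ in (0:ℝ)..π, G θ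
  have hn1 : ((n:ℂ)+1) ≠ 0 := by exact_mod_cast Nat.succ_ne_zero n
  rw [dist_eq_norm]
  have split : 1 / ((n:ℂ)+1) * E - 1 / (2 * (π:ℂ)) * (2 * I)
      = ((1 / ((n:ℝ)+1) : ℝ) : ℂ) * (E - Q)
        + ((1 / π : ℝ) : ℂ) * ((π / ((n:ℝ)+1) : ℝ) * Q - I) := by
    push_cast
    field_simp
    ring
  rw [split]
  refine (norm_add_le _ _).trans_lt ?_
  rw [norm_mul, norm_mul, Complex.norm_real, Complex.norm_real, Real.norm_of_nonneg (by positivity),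
    Real.norm_of_nonneg (by positivity)]
  have b1 : 1 / ((n:ℝ)+1) * ‖E - Q‖ ≤ 1 / ((n:ℝ)+1) * (4 * C) := by gcongr
  have b2 : 1 / π * ‖((π / ((n:ℝ)+1) : ℝ) : ℂ) * Q - I‖ ≤ 1 / π * (ε * π / 2) := by gcongr
  have b3 : 1 / π * (ε * π / 2) = ε / 2 := by field_simp
  linarith
end

section
/- (Spectral distribution in 2D.) Fix ϑ_S ∈ (0,1) and for each n ≥ 1 let A_h be the n(n+1)×n(n+1) 2D Coco–Russo matrix with h = 1/(n+1). Then {h² A_h} ∼_λ 4 − 2cos θ₁ − 2cos θ₂; that is, for every continuous compactly supported function F : ℂ → ℂ, lim_{n→∞} (1/(n(n+1))) Σ_{i=1}^{n(n+1)} F(λ_i(h² A_h)) = (1/(2π)²) ∫_{[−π,π]²} F(4 − 2cos θ₁ − 2cos θ₂) dθ₁ dθ₂, where the λ_i(h²A_h) are the eigenvalues of h²A_h counted with multiplicity. -/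
open Matrix Real Filter Kronecker

/-- the `n(n+1)×n(n+1)` matrix `X_n`: all rows zero except the first `n` (block row `0`),
which equal `[T_n(h²ϑ_S−4+2cosθ) | (h²(1−ϑ_S)+1)I_n | 0]`; rows and columns are indexed
lexicographically by pairs `(block index, inner index) : Fin (n+1) × Fin n`. -/
noncomputable def X (n : ℕ) (ϑ : ℝ) :
    Matrix (Fin (n+1) × Fin n) (Fin (n+1) × Fin n) ℝ :=
  Matrix.of fun p q =>
    if p.1.1 = 0 then
      (if q.1.1 = 0 then trid n ((h n)^2 * ϑ - 4) 1 p.2 q.2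
       else if q.1.1 = 1 then ((h n)^2 * (1-ϑ) + 1) * (if p.2 = q.2 then 1 else 0)
       else 0)
    else 0

/-- `h²A_h = T_{n+1}(2−2cosθ) ⊗ I_n + I_{n+1} ⊗ T_n(2−2cosθ) + X_n` -/
noncomputable def h2A (n : ℕ) (ϑ : ℝ) :
    Matrix (Fin (n+1) × Fin n) (Fin (n+1) × Fin n) ℝ :=
  T (n+1) ⊗ₖ (1 : Matrix (Fin n) (Fin n) ℝ)
    + (1 : Matrix (Fin (n+1)) (Fin (n+1)) ℝ) ⊗ₖ T n
    + X n ϑ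

lemma det_two_expand {n : ℕ} (M : Matrix (Fin (n+2)) (Fin (n+2)) ℝ)
    (hr : ∀ j : Fin n, M 0 j.succ.succ = 0) (hc : ∀ i : Fin n, M i.succ.succ 0 = 0) :
    M.det = M 0 0 * (M.submatrix Fin.succ Fin.succ).det
      - M 0 1 * M 1 0 * (M.submatrix (fun i : Fin n => i.succ.succ) (fun i : Fin n => i.succ.succ)).det := by
  rw [Matrix.det_succ_row_zero, Fin.sum_univ_succ, Fin.sum_univ_succ]
  have h1 : (M.submatrix Fin.succ (Fin.succAbove 1)).det =
      M 1 0 * (M.submatrix (fun i : Fin n => i.succ.succ) (fun i : Fin n => i.succ.succ)).det := by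
    rw [Matrix.det_succ_column_zero, Fin.sum_univ_succ]
    have : ∀ i : Fin n, (M.submatrix Fin.succ (Fin.succAbove 1)) i.succ 0 = 0 := by
      intro i
      simpa using hc i
    simp only [this]
    simp only [Fin.val_zero, pow_zero, one_mul, submatrix_apply, mul_zero, zero_mul,
      Finset.sum_const_zero, add_zero, submatrix_submatrix]
    congr 1
  simp only [Fin.succ_zero_eq_one, h1, hr]
  simp
  ring

lemma det_trid (N : ℕ) (x : ℝ) :
    (trid N x 1).det = (Polynomial.Chebyshev.S ℝ N).eval x := by
  induction N using Nat.strong_induction_on with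
  | _ N ih =>
    match N with
    | 0 => simp
    | 1 => simp [trid]
    | n+2 =>
      rw [det_two_expand]
      · have e1 : (trid (n+2) x 1).submatrix Fin.succ Fin.succ = trid (n+1) x 1 := by
          ext i j; simp [trid]
        have e2 : (trid (n+2) x 1).submatrix (fun i : Fin n => i.succ.succ)
            (fun i : Fin n => i.succ.succ) = trid n x 1 := by
          ext i j; simp [trid]
        rw [e1, e2, ih _ (by omega), ih _ (by omega)]
        have := Polynomial.Chebyshev.S_add_two ℝ (n:ℤ)
        push_cast
        rw [this]
        simp [trid]
      · intro j; simp [trid, Fin.ext_iff]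
      · intro j; simp [trid, Fin.ext_iff]

/-- the block of `h2A` belonging to an eigenvalue `l` of `T n` -/
noncomputable def Cb (n : ℕ) (ϑ l : ℝ) : Matrix (Fin (n+1)) (Fin (n+1)) ℝ :=
  Matrix.of fun i j =>
    if i.1 = 0 then
      (if j.1 = 0 then (h n)^2 * ϑ else if j.1 = 1 then (h n)^2 * (1-ϑ) else 0)
    else trid (n+1) (2+l) (-1) i j

lemma charpoly_Cb_eval (n : ℕ) (ϑ l t : ℝ) :
    (Cb (n+1) ϑ l).charpoly.eval t =
      (t - (h (n+1))^2 * ϑ) * (Polynomial.Chebyshev.S ℝ ((n:ℤ)+1)).eval (t - (2+l))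
      + (h (n+1))^2 * (1-ϑ) * (Polynomial.Chebyshev.S ℝ n).eval (t - (2+l)) := by
  rw [Matrix.eval_charpoly, det_two_expand]
  · have e1 : (Matrix.scalar (Fin (n+1+1)) t - Cb (n+1) ϑ l).submatrix Fin.succ Fin.succ
        = trid (n+1) (t - (2+l)) 1 := by
      ext i j
      simp [trid, Cb, Matrix.diagonal_apply]
      split_ifs <;> simp
    have e2 : (Matrix.scalar (Fin (n+1+1)) t - Cb (n+1) ϑ l).submatrix
        (fun i : Fin n => i.succ.succ) (fun i : Fin n => i.succ.succ)
        = trid n (t - (2+l)) 1 := by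
      ext i j
      simp [trid, Cb, Matrix.diagonal_apply]
      split_ifs <;> simp
    rw [e1, e2, det_trid, det_trid]
    simp [trid, Cb]
  · intro j; simp [Cb, Fin.ext_iff, -Fin.val_eq_zero_iff]
  · intro j; simp [trid, Cb, Fin.ext_iff, -Fin.val_eq_zero_iff]

lemma charpoly_T_eval (n : ℕ) (t : ℝ) :
    (T n).charpoly.eval t = (Polynomial.Chebyshev.S ℝ n).eval (t - 2) := by
  rw [Matrix.eval_charpoly, ← det_trid]
  congr 1
  ext i j
  simp [T, trid, Matrix.diagonal_apply]
  split_ifs <;> simp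

lemma T_herm (n : ℕ) : (T n).IsHermitian := by
  ext i j
  simp [T, trid, Fin.ext_iff]
  grind

lemma h2A_eq (n : ℕ) (ϑ : ℝ) :
    h2A n ϑ = Cb n ϑ 0 ⊗ₖ (1 : Matrix (Fin n) (Fin n) ℝ)
      + Matrix.diagonal (fun i : Fin (n+1) => if i.1 = 0 then (0:ℝ) else 1) ⊗ₖ T n := by
  ext ⟨i, k⟩ ⟨j, l⟩
  simp only [h2A, X, Cb, T, trid, Matrix.add_apply, Matrix.kroneckerMap_apply, Matrix.of_apply,
    Matrix.one_apply, Matrix.diagonal_apply]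
  by_cases hi : i.1 = 0
  · by_cases hj : j.1 = 0
    · have : i = j := Fin.ext (by omega)
      simp only [this, hj, if_true]
      split_ifs <;> ring
    · have : i ≠ j := fun e => hj (e ▸ hi)
      by_cases hj1 : j.1 = 1
      · simp [hi, hj1, this]
        split_ifs <;> ring
      · have : ¬ (1 = j.1) := fun e => hj1 e.symm
        simp [*]
  · simp only [hi, if_false]
    split_ifs <;> ring

lemma blockDiag_eq (n : ℕ) (ϑ : ℝ) (d : Fin n → ℝ) :
    Matrix.blockDiagonal (fun k => Cb n ϑ (d k)) = Cb n ϑ 0 ⊗ₖ (1 : Matrix (Fin n) (Fin n) ℝ)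
      + Matrix.diagonal (fun i : Fin (n+1) => if i.1 = 0 then (0:ℝ) else 1) ⊗ₖ
        Matrix.diagonal d := by
  ext ⟨i, k⟩ ⟨j, l⟩
  simp only [Cb, trid, Matrix.add_apply, Matrix.kroneckerMap_apply, Matrix.of_apply,
    Matrix.one_apply, Matrix.diagonal_apply, Matrix.blockDiagonal_apply]
  split_ifs <;> simp_all

lemma charpoly_blockDiag {n m : ℕ} (M : Fin m → Matrix (Fin n) (Fin n) ℝ) :
    (Matrix.blockDiagonal M).charpoly = ∏ k, (M k).charpoly := by
  unfold Matrix.charpoly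
  rw [← Matrix.det_blockDiagonal]
  congr 1
  ext1 ⟨i, k⟩ ⟨j, l⟩
  simp only [Matrix.charmatrix_apply, Matrix.blockDiagonal_apply, Matrix.diagonal_apply,
    Prod.mk.injEq]
  split_ifs <;> simp_all

lemma charpoly_h2A (n : ℕ) (ϑ : ℝ) :
    (h2A n ϑ).charpoly = ∏ k, (Cb n ϑ ((T_herm n).eigenvalues k)).charpoly := by
  rw [← charpoly_blockDiag, blockDiag_eq, h2A_eq]
  set d := (T_herm n).eigenvalues with hd
  set U : Matrix (Fin n) (Fin n) ℝ := ((T_herm n).eigenvectorUnitary : Matrix (Fin n) (Fin n) ℝ)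
    with hU
  have hs : T n = U * Matrix.diagonal d * star U := by
    conv_lhs => rw [(T_herm n).spectral_theorem, Unitary.conjStarAlgAut_apply]
    rfl
  have hUU : U * star U = 1 := Unitary.coe_mul_star_self _
  have hUU' : star U * U = 1 := Unitary.coe_star_mul_self _
  set P := Matrix.diagonal (fun i : Fin (n+1) => if i.1 = 0 then (0:ℝ) else 1)
  set E := Cb n ϑ 0
  have key : E ⊗ₖ (1 : Matrix (Fin n) (Fin n) ℝ) + P ⊗ₖ T n =
      ((1 : Matrix (Fin (n+1)) (Fin (n+1)) ℝ) ⊗ₖ U) *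
      ((E ⊗ₖ (1 : Matrix (Fin n) (Fin n) ℝ) + P ⊗ₖ Matrix.diagonal d) *
        ((1 : Matrix (Fin (n+1)) (Fin (n+1)) ℝ) ⊗ₖ star U)) := by
    rw [hs, add_mul, mul_add, ← Matrix.mul_kronecker_mul, ← Matrix.mul_kronecker_mul,
      ← Matrix.mul_kronecker_mul, ← Matrix.mul_kronecker_mul]
    simp [hUU, mul_assoc]
  rw [key, Matrix.charpoly_mul_comm, mul_assoc, ← Matrix.mul_kronecker_mul, hUU']
  simp

/-- grid points `(j+1)π/(n+1)` -/
noncomputable def th (n j : ℕ) : ℝ := ((j:ℝ)+1) * π / ((n:ℝ)+1)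

lemma th_pos (n j : ℕ) : 0 < th n j := by
  unfold th; positivity

lemma th_lt (n j : ℕ) (hj : j < n) : th n j < π := by
  unfold th
  have : (j:ℝ) < n := by exact_mod_cast hj
  rw [div_lt_iff₀ (by positivity)]
  nlinarith [Real.pi_pos]

lemma S_eval_n (n j : ℕ) (hj : j < n) :
    (Polynomial.Chebyshev.S ℝ n).eval (-(2 * Real.cos (th n j))) = 0 := by
  have h1 := Polynomial.Chebyshev.S_two_mul_real_cos (π - th n j) n
  have hs : 0 < Real.sin (π - th n j) := by
    rw [Real.sin_pi_sub]; exact Real.sin_pos_of_pos_of_lt_pi (th_pos n j) (th_lt n j hj)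
  have h2 : Real.sin ((((n:ℤ):ℝ) + 1) * (π - th n j)) = 0 := by
    have : (((n:ℤ):ℝ) + 1) * (π - th n j) = ((n:ℤ) - (j:ℤ) : ℤ) * π := by
      unfold th; push_cast; field_simp; ring
    rw [this]; exact Real.sin_int_mul_pi _
  rw [h2, Real.cos_pi_sub] at h1
  have := (mul_eq_zero.mp h1).resolve_right hs.ne'
  simpa using this

lemma S_eval_pred (m j : ℕ) (hj : j < m+1) :
    (Polynomial.Chebyshev.S ℝ m).eval (-(2 * Real.cos (th (m+1) j))) = -(-1)^(m+1-j) := by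
  have h1 := Polynomial.Chebyshev.S_two_mul_real_cos (π - th (m+1) j) m
  have hs : 0 < Real.sin (π - th (m+1) j) := by
    rw [Real.sin_pi_sub]
    exact Real.sin_pos_of_pos_of_lt_pi (th_pos _ j) (th_lt _ j hj)
  have h2 : Real.sin ((((m:ℤ):ℝ) + 1) * (π - th (m+1) j))
      = -(-1)^(m+1-j) * Real.sin (π - th (m+1) j) := by
    have : (((m:ℤ):ℝ) + 1) * (π - th (m+1) j) = ((m+1-j : ℕ):ℝ) * π - (π - th (m+1) j) := by
      rw [Nat.cast_sub (by omega)]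
      unfold th; push_cast; field_simp; ring
    rw [this, Real.sin_sub, Real.sin_nat_mul_pi, Real.cos_nat_mul_pi]
    ring
  rw [h2, Real.cos_pi_sub] at h1
  have := mul_right_cancel₀ hs.ne' h1
  simpa using this

lemma roots_T (n : ℕ) :
    (T n).charpoly.roots = (Finset.range n).val.map (fun j => 2 - 2 * Real.cos (th n j)) := by
  symm
  apply Multiset.eq_of_le_of_card_le
  · have hnd : ((Finset.range n).val.map (fun j => 2 - 2 * Real.cos (th n j))).Nodup := by
      refine Multiset.Nodup.map_on ?_ (Finset.range n).nodup
      intro i hi j hj hij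
      simp only [Finset.mem_val, Finset.mem_range] at hi hj
      have hc : Real.cos (th n i) = Real.cos (th n j) := by linarith
      have := Real.injOn_cos ⟨(th_pos n i).le, (th_lt n i hi).le⟩
        ⟨(th_pos n j).le, (th_lt n j hj).le⟩ hc
      unfold th at this
      field_simp at this
      have h3 : (i:ℝ) = j := by linarith
      exact_mod_cast h3
    rw [Multiset.le_iff_subset hnd]
    intro y hy
    simp only [Multiset.mem_map, Finset.mem_val, Finset.mem_range] at hy
    obtain ⟨j, hj, rfl⟩ := hy
    rw [Polynomial.mem_roots (Matrix.charpoly_monic _).ne_zero, Polynomial.IsRoot,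
      charpoly_T_eval]
    have := S_eval_n n j hj
    rw [← this]; congr 1; ring
  · refine (Polynomial.card_roots' _).trans ?_
    rw [Matrix.charpoly_natDegree_eq_dim]
    simp

lemma sum_eigT (n : ℕ) (g : ℝ → ℂ) :
    ∑ k, g ((T_herm n).eigenvalues k) = ∑ j ∈ Finset.range n, g (2 - 2 * Real.cos (th n j)) := by
  have h1 := (T_herm n).roots_charpoly_eq_eigenvalues
  rw [roots_T] at h1
  have h2 := congrArg (fun s => (Multiset.map g s).sum) h1
  simp only [Multiset.map_map] at h2
  exact h2.symm

lemma roots_compare (q : Polynomial ℝ) (m : ℕ) (hq : q ≠ 0) (hdeg : q.natDegree ≤ m + 2)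
    (x : ℕ → ℝ) (hmono : ∀ i j, i ≤ j → j ≤ m → x i ≤ x j)
    (hs : ∀ j < m, q.eval (x j) * q.eval (x (j+1)) < 0)
    (F : ℂ → ℂ) (M ε : ℝ) (hM : ∀ z, ‖F z‖ ≤ M)
    (hε : ∀ j < m, ∀ y ∈ Set.Icc (x j) (x (j+1)), ‖F (y:ℂ) - F (x j : ℂ)‖ ≤ ε) :
    ‖((q.map (algebraMap ℝ ℂ)).roots.map F).sum - ∑ j ∈ Finset.range (m+1), F (x j : ℂ)‖
      ≤ m * ε + 3 * M := by
  have hM0 : 0 ≤ M := (norm_nonneg _).trans (hM 0)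
  have hroot : ∀ j, ∃ y, j < m → (x j < y ∧ y < x (j+1) ∧ q.eval y = 0) := by
    intro j
    by_cases hj : j < m
    · have hc : ContinuousOn (fun t => q.eval t) (Set.Icc (x j) (x (j+1))) :=
        q.continuous.continuousOn
      have hle := hmono j (j+1) (by omega) (by omega)
      rcases mul_neg_iff.mp (hs j hj) with ⟨ha, hb⟩ | ⟨ha, hb⟩
      · obtain ⟨y, hy, hy0⟩ := intermediate_value_Ioo' hle hc ⟨hb, ha⟩
        exact ⟨y, fun _ => ⟨hy.1, hy.2, hy0⟩⟩
      · obtain ⟨y, hy, hy0⟩ := intermediate_value_Ioo hle hc ⟨ha, hb⟩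
        exact ⟨y, fun _ => ⟨hy.1, hy.2, hy0⟩⟩
    · exact ⟨0, fun h => absurd h hj⟩
  choose ξ hξ using hroot
  have hlt : ∀ i j, i < j → j < m → ξ i < ξ j := by
    intro i j hij hj
    calc ξ i < x (i+1) := (hξ i (by omega)).2.1
      _ ≤ x j := hmono _ _ (by omega) (by omega)
      _ < ξ j := (hξ j hj).1
  set s : Multiset ℂ := (Finset.range m).val.map (fun j => (ξ j : ℂ)) with hsdef
  have hnd : s.Nodup := by
    refine Multiset.Nodup.map_on ?_ (Finset.range m).nodup
    intro i hi j hj hij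
    simp only [Finset.mem_val, Finset.mem_range] at hi hj
    have hij' : ξ i = ξ j := by exact_mod_cast hij
    rcases lt_trichotomy i j with h1 | h1 | h1
    · exact absurd hij' (hlt i j h1 hj).ne
    · exact h1
    · exact absurd hij' (hlt j i h1 hi).ne'
  have hq' : q.map (algebraMap ℝ ℂ) ≠ 0 := by
    simpa [Polynomial.map_eq_zero] using hq
  have hle : s ≤ (q.map (algebraMap ℝ ℂ)).roots := by
    rw [Multiset.le_iff_subset hnd]
    intro y hy
    simp only [hsdef, Multiset.mem_map, Finset.mem_val, Finset.mem_range] at hy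
    obtain ⟨j, hj, rfl⟩ := hy
    rw [Polynomial.mem_roots hq', Polynomial.IsRoot]
    have := Polynomial.eval_map_algebraMap (B := ℂ) q ((ξ j : ℝ) : ℂ)
    have h2 := Polynomial.aeval_algebraMap_apply ℂ (ξ j) q
    rw [this]
    have h3 : (algebraMap ℝ ℂ) (ξ j) = (ξ j : ℂ) := rfl
    rw [h3] at h2
    rw [h2]
    simp [(hξ j hj).2.2]
  obtain ⟨R, hR⟩ := Multiset.le_iff_exists_add.mp hle
  have hcard : R.card ≤ 2 := by
    have h1 : (q.map (algebraMap ℝ ℂ)).roots.card ≤ m + 2 :=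
      (Polynomial.card_roots' _).trans ((Polynomial.natDegree_map_le).trans hdeg)
    rw [hR, Multiset.card_add] at h1
    have : s.card = m := by simp [hsdef]
    omega
  have hRsum : ‖(R.map F).sum‖ ≤ 2 * M := by
    have h1 : ‖(R.map F).sum‖ ≤ R.card • M := by
      have := Multiset.le_sum_of_subadditive (fun z : ℂ => ‖z‖) norm_zero.le norm_add_le (R.map F)
      refine this.trans ?_
      rw [Multiset.map_map]
      have h4 := Multiset.sum_le_card_nsmul (R.map ((fun z : ℂ => ‖z‖) ∘ F)) M (by
        intro y hy
        obtain ⟨z, -, rfl⟩ := Multiset.mem_map.mp hy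
        exact hM z)
      simpa using h4
    refine h1.trans ?_
    rw [nsmul_eq_mul]
    have : (R.card : ℝ) ≤ 2 := by exact_mod_cast hcard
    nlinarith
  have hssum : (s.map F).sum = ∑ j ∈ Finset.range m, F (ξ j) := by
    rw [hsdef, Multiset.map_map]; rfl
  rw [hR, Multiset.map_add, Multiset.sum_add, hssum, Finset.sum_range_succ]
  have e : ∑ j ∈ Finset.range m, F (ξ j) + (R.map F).sum
      - (∑ j ∈ Finset.range m, F (x j : ℂ) + F (x m))
      = ∑ j ∈ Finset.range m, (F (ξ j) - F (x j : ℂ)) + (R.map F).sum - F (x m) := by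
    rw [Finset.sum_sub_distrib]; ring
  rw [e]
  have h1 : ‖∑ j ∈ Finset.range m, (F (ξ j) - F (x j : ℂ))‖ ≤ m * ε := by
    refine (norm_sum_le_of_le _ (f := fun j => (F (ξ j) - F (x j : ℂ))) (n := fun _ => ε)
      ?_).trans ?_
    · intro j hj
      have hj' := Finset.mem_range.mp hj
      exact hε j hj' _ ⟨(hξ j hj').1.le, (hξ j hj').2.1.le⟩
    · simp
  have h2 := norm_sub_le (∑ j ∈ Finset.range m, (F (ξ j) - F (x j : ℂ)) + (R.map F).sum) (F (x m))
  have h3 := norm_add_le (∑ j ∈ Finset.range m, (F (ξ j) - F (x j : ℂ))) (R.map F).sum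
  have h4 := hM (x m)
  linarith

lemma th_mono (n i j : ℕ) (hij : i ≤ j) : th n i ≤ th n j := by
  unfold th
  have : (i:ℝ) ≤ j := by exact_mod_cast hij
  gcongr

lemma block_compare (m : ℕ) (ϑ l : ℝ) (hϑ : ϑ < 1) (F : ℂ → ℂ) (M ε δ : ℝ)
    (hM : ∀ z, ‖F z‖ ≤ M) (hδ : ∀ z w, ‖z - w‖ < δ → ‖F z - F w‖ ≤ ε)
    (hm : 2 * (π / ((m:ℝ)+2)) < δ) :
    ‖(((Cb (m+1) ϑ l).charpoly.map (algebraMap ℝ ℂ)).roots.map F).sum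
      - ∑ j ∈ Finset.range (m+1), F ((2 + l - 2 * Real.cos (th (m+1) j) : ℝ) : ℂ)‖
      ≤ m * ε + 3 * M := by
  have hval : ∀ j < m+1, (Cb (m+1) ϑ l).charpoly.eval (2 + l - 2 * Real.cos (th (m+1) j))
      = (h (m+1))^2 * (1-ϑ) * (-(-1)^(m+1-j)) := by
    intro j hj
    rw [charpoly_Cb_eval]
    have e : 2 + l - 2 * Real.cos (th (m+1) j) - (2 + l) = -(2 * Real.cos (th (m+1) j)) := by ring
    have h1 := S_eval_n (m+1) j hj
    push_cast at h1
    rw [e, h1, S_eval_pred m j hj]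
    ring
  refine roots_compare (Cb (m+1) ϑ l).charpoly m (Matrix.charpoly_monic _).ne_zero ?_
    (fun j => 2 + l - 2 * Real.cos (th (m+1) j)) ?_ ?_ F M ε hM ?_
  · rw [Matrix.charpoly_natDegree_eq_dim]; simp
  · intro i j hij hj
    have := Real.cos_le_cos_of_nonneg_of_le_pi (th_pos (m+1) i).le
      (th_lt (m+1) j (by omega)).le (th_mono (m+1) i j hij)
    linarith
  · intro j hj
    rw [hval j (by omega), hval (j+1) (by omega)]
    have e : m + 1 - j = (m + 1 - (j+1)) + 1 := by omega
    rw [e, pow_succ (-1:ℝ)]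
    set k := m + 1 - (j+1)
    have hh : 0 < (h (m+1))^2 * (1-ϑ) := by
      have : 0 < h (m+1) := by unfold h; positivity
      have : 0 < 1 - ϑ := by linarith
      positivity
    have hk : ((-1:ℝ)^k)^2 = 1 := by rw [← pow_mul, mul_comm, pow_mul]; simp
    have : (h (m+1))^2 * (1-ϑ) * (-((-1)^k * (-1))) * ((h (m+1))^2 * (1-ϑ) * (-(-1)^k))
      = -(((h (m+1))^2 * (1-ϑ))^2 * ((-1:ℝ)^k)^2) := by ring
    rw [this, hk]
    have : 0 < ((h (m+1))^2 * (1-ϑ))^2 := by positivity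
    linarith
  · intro j hj y hy
    apply hδ
    rw [← Complex.ofReal_sub, Complex.norm_real, Real.norm_eq_abs]
    have h1 : |Real.cos (th (m+1) j) - Real.cos (th (m+1) (j+1))| ≤
        |th (m+1) j - th (m+1) (j+1)| := Real.abs_cos_sub_cos_le _ _
    have h2 : th (m+1) j - th (m+1) (j+1) = -(π / ((m:ℝ)+2)) := by
      unfold th; push_cast; field_simp; ring
    rw [h2, abs_neg, abs_of_pos (show 0 < π / ((m:ℝ)+2) by positivity)] at h1
    rw [abs_lt]
    have := abs_le.mp h1
    constructor <;> linarith [hy.1, hy.2]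

lemma riemann_one (g : ℝ → ℂ) (hg : Continuous g) (n : ℕ) (M ε : ℝ) (hM : ∀ x, ‖g x‖ ≤ M)
    (hε : ∀ x y, |x - y| ≤ π / ((n:ℝ)+1) → ‖g x - g y‖ ≤ ε) :
    ‖((π / ((n:ℝ)+1) : ℝ) : ℂ) * ∑ j ∈ Finset.range n, g (th n j) - ∫ t in (0:ℝ)..π, g t‖
      ≤ π * ε + M * (π / ((n:ℝ)+1)) := by
  set c : ℝ := π / ((n:ℝ)+1) with hc
  have hc0 : 0 < c := by positivity
  set a : ℕ → ℝ := fun j => (j:ℝ) * c with ha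
  have hth : ∀ j, th n j = a (j+1) := by
    intro j; simp only [th, ha, hc]; push_cast; ring
  have hsum : ∑ j ∈ Finset.range (n+1), ∫ t in (a j)..(a (j+1)), g t = ∫ t in (0:ℝ)..π, g t := by
    rw [intervalIntegral.sum_integral_adjacent_intervals
      (fun k _ => hg.intervalIntegrable _ _)]
    congr 1
    · simp [ha]
    · simp only [ha, hc]; push_cast; field_simp
  have hstep : ∀ j, ‖(c:ℂ) * g (a (j+1)) - ∫ t in (a j)..(a (j+1)), g t‖ ≤ ε * c := by
    intro j
    have hd : a (j+1) - a j = c := by simp only [ha]; push_cast; ring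
    have h1 : (c:ℂ) * g (a (j+1)) = ∫ t in (a j)..(a (j+1)), g (a (j+1)) := by
      rw [intervalIntegral.integral_const, hd, Complex.real_smul]
    rw [h1, ← intervalIntegral.integral_sub (intervalIntegrable_const)
      (hg.intervalIntegrable _ _)]
    refine (intervalIntegral.norm_integral_le_of_norm_le_const (C := ε) ?_).trans ?_
    · intro t ht
      rw [Set.uIoc_of_le (by linarith)] at ht
      apply hε
      rw [abs_le]
      constructor <;> linarith [ht.1, ht.2]
    · rw [hd, abs_of_pos hc0]
  have e : (c:ℂ) * ∑ j ∈ Finset.range n, g (th n j) - ∫ t in (0:ℝ)..π, g t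
      = ∑ j ∈ Finset.range (n+1), ((c:ℂ) * g (a (j+1)) - ∫ t in (a j)..(a (j+1)), g t)
        - (c:ℂ) * g (a (n+1)) := by
    rw [Finset.sum_sub_distrib, hsum, Finset.sum_range_succ _ n, Finset.mul_sum]
    simp only [hth]; ring
  rw [e]
  refine (norm_sub_le _ _).trans (add_le_add ?_ ?_)
  · refine (norm_sum_le_of_le _ (fun j _ => hstep j)).trans ?_
    simp only [Finset.sum_const, Finset.card_range, nsmul_eq_mul, hc]
    push_cast
    apply le_of_eq; field_simp
  · rw [norm_mul, Complex.norm_real, Real.norm_eq_abs, abs_of_pos hc0, mul_comm]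
    exact mul_le_mul_of_nonneg_right (hM _) hc0.le

lemma riemann_two (G : ℝ → ℝ → ℂ) (hG : Continuous (Function.uncurry G)) (n : ℕ) (M ε : ℝ)
    (hM : ∀ x y, ‖G x y‖ ≤ M)
    (h1 : ∀ x x' y, |x - x'| ≤ π / ((n:ℝ)+1) → ‖G x y - G x' y‖ ≤ ε)
    (h2 : ∀ x y y', |y - y'| ≤ π / ((n:ℝ)+1) → ‖G x y - G x y'‖ ≤ ε) :
    ‖((π / ((n:ℝ)+1) : ℝ) : ℂ)^2 * ∑ i ∈ Finset.range n, ∑ j ∈ Finset.range n,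
        G (th n i) (th n j) - ∫ s in (0:ℝ)..π, ∫ t in (0:ℝ)..π, G s t‖
      ≤ 2 * π^2 * ε + 2 * π * M * (π / ((n:ℝ)+1)) := by
  have hGx : ∀ x, Continuous (G x) := fun x =>
    hG.comp (Continuous.prodMk continuous_const continuous_id)
  have hpi := Real.pi_pos
  have hM0 : 0 ≤ M := (norm_nonneg _).trans (hM 0 0)
  have hI : Continuous (fun s => ∫ t in (0:ℝ)..π, G s t) :=
    intervalIntegral.continuous_parametric_intervalIntegral_of_continuous' hG 0 π
  have hout := riemann_one (fun s => ∫ t in (0:ℝ)..π, G s t) hI n (M * π) (ε * π) (by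
      intro x
      have := intervalIntegral.norm_integral_le_of_norm_le_const (a := (0:ℝ)) (b := π)
        (f := G x) (C := M) (fun t _ => hM x t)
      rwa [sub_zero, abs_of_pos hpi] at this) (by
      intro x y hxy
      rw [← intervalIntegral.integral_sub ((hGx x).intervalIntegrable _ _)
        ((hGx y).intervalIntegrable _ _)]
      have := intervalIntegral.norm_integral_le_of_norm_le_const (a := (0:ℝ)) (b := π)
        (f := fun t => G x t - G y t) (C := ε) (fun t _ => h1 x y t hxy)
      rwa [sub_zero, abs_of_pos hpi] at this)
  have hin : ∀ x, _ := fun x => riemann_one (G x) (hGx x) n M ε (hM x) (h2 x)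
  set c : ℝ := π / ((n:ℝ)+1) with hc
  have hc0 : 0 < c := by positivity
  have hε0 : 0 ≤ ε := (norm_nonneg _).trans (h1 0 0 0 (by simpa using hc0.le))
  have e : (c:ℂ)^2 * ∑ i ∈ Finset.range n, ∑ j ∈ Finset.range n,
        G (th n i) (th n j) - ∫ s in (0:ℝ)..π, ∫ t in (0:ℝ)..π, G s t
      = (c:ℂ) * ∑ i ∈ Finset.range n, ((c:ℂ) * ∑ j ∈ Finset.range n, G (th n i) (th n j)
          - ∫ t in (0:ℝ)..π, G (th n i) t)
        + ((c:ℂ) * ∑ i ∈ Finset.range n, (∫ t in (0:ℝ)..π, G (th n i) t)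
          - ∫ s in (0:ℝ)..π, ∫ t in (0:ℝ)..π, G s t) := by
    rw [Finset.sum_sub_distrib, ← Finset.mul_sum]; ring
  rw [e]
  refine (norm_add_le _ _).trans ?_
  have hA : ‖(c:ℂ) * ∑ i ∈ Finset.range n, ((c:ℂ) * ∑ j ∈ Finset.range n, G (th n i) (th n j)
          - ∫ t in (0:ℝ)..π, G (th n i) t)‖ ≤ π * (π * ε + M * c) := by
    rw [norm_mul, Complex.norm_real, Real.norm_eq_abs, abs_of_pos hc0]
    have h3 := norm_sum_le_of_le (Finset.range n) (fun i _ => hin (th n i))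
    simp only [Finset.sum_const, Finset.card_range, nsmul_eq_mul] at h3
    have h4 : c * n ≤ π := by
      rw [hc, div_mul_eq_mul_div, div_le_iff₀ (by positivity)]; nlinarith
    calc _ ≤ c * (n * (π * ε + M * c)) := mul_le_mul_of_nonneg_left h3 hc0.le
      _ = (c * n) * (π * ε + M * c) := by ring
      _ ≤ _ := mul_le_mul_of_nonneg_right h4 (by positivity)
  linarith

lemma even_integral (g : ℝ → ℂ) (hg : Continuous g) (he : ∀ x, g (-x) = g x) :
    ∫ t in (-π)..π, g t = 2 * ∫ t in (0:ℝ)..π, g t := by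
  rw [← intervalIntegral.integral_add_adjacent_intervals (b := 0)
    (hg.intervalIntegrable _ _) (hg.intervalIntegrable _ _)]
  have : ∫ t in (-π)..0, g t = ∫ t in (0:ℝ)..π, g t := by
    have := intervalIntegral.integral_comp_neg (a := (0:ℝ)) (b := π) g
    simp only [he, neg_zero] at this
    exact this.symm
  rw [this]; ring

lemma eigs_sum (n : ℕ) (ϑ : ℝ) (F : ℂ → ℂ) :
    ((eigs (h2A n ϑ)).map F).sum = ∑ k, (((Cb n ϑ ((T_herm n).eigenvalues k)).charpoly.map
      (algebraMap ℝ ℂ)).roots.map F).sum := by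
  unfold eigs
  rw [Matrix.charpoly_map, charpoly_h2A, Polynomial.map_prod, Polynomial.roots_prod]
  · rw [Multiset.map_bind, Multiset.sum_bind]
    rfl
  · rw [Finset.prod_ne_zero_iff]
    intro k _
    exact ((Matrix.charpoly_monic _).map _).ne_zero

lemma total_compare (m : ℕ) (ϑ : ℝ) (hϑ : ϑ < 1) (F : ℂ → ℂ) (M ε δ : ℝ)
    (hM : ∀ z, ‖F z‖ ≤ M) (hδ : ∀ z w, ‖z - w‖ < δ → ‖F z - F w‖ ≤ ε)
    (hm : 2 * (π / ((m:ℝ)+2)) < δ) :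
    ‖((eigs (h2A (m+1) ϑ)).map F).sum
      - ∑ i ∈ Finset.range (m+1), ∑ j ∈ Finset.range (m+1),
        F ((4 - 2 * Real.cos (th (m+1) i) - 2 * Real.cos (th (m+1) j) : ℝ) : ℂ)‖
      ≤ (m+1) * (m * ε + 3 * M) := by
  have h1 := sum_eigT (m+1) (fun l => ∑ j ∈ Finset.range (m+1),
    F ((2 + l - 2 * Real.cos (th (m+1) j) : ℝ) : ℂ))
  have h2 : ∑ i ∈ Finset.range (m+1), ∑ j ∈ Finset.range (m+1),
        F ((4 - 2 * Real.cos (th (m+1) i) - 2 * Real.cos (th (m+1) j) : ℝ) : ℂ)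
      = ∑ k, ∑ j ∈ Finset.range (m+1),
        F ((2 + (T_herm (m+1)).eigenvalues k - 2 * Real.cos (th (m+1) j) : ℝ) : ℂ) := by
    rw [h1]
    refine Finset.sum_congr rfl fun i _ => Finset.sum_congr rfl fun j _ => ?_
    congr 2; ring
  rw [h2, eigs_sum, ← Finset.sum_sub_distrib]
  refine (norm_sum_le_of_le _ (fun k _ => block_compare m ϑ _ hϑ F M ε δ hM hδ hm)).trans ?_
  simp [mul_add]

lemma scaled_tendsto (ϑS : ℝ) (hϑ : ϑS < 1)
    (F : ℂ → ℂ) (hF : Continuous F) (hFc : HasCompactSupport F) :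
    Tendsto (fun n : ℕ => ((π / ((n:ℝ)+1) : ℝ) : ℂ)^2 * ((eigs (h2A n ϑS)).map F).sum) atTop
      (nhds (∫ s in (0:ℝ)..π, ∫ t in (0:ℝ)..π,
        F ((4 - 2 * Real.cos s - 2 * Real.cos t : ℝ) : ℂ))) := by
  obtain ⟨M, hM⟩ := hF.bounded_above_of_compact_support hFc
  have hM0 : 0 ≤ M := (norm_nonneg _).trans (hM 0)
  have hpi := Real.pi_pos
  have huc : UniformContinuous F := hFc.uniformContinuous_of_continuous hF
  rw [Metric.tendsto_atTop']
  intro η hη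
  set ε : ℝ := η / (6 * π^2) with hε
  have hε0 : 0 < ε := by positivity
  obtain ⟨δ, hδ0, hδ⟩ := Metric.uniformContinuous_iff.mp huc ε hε0
  have hδ' : ∀ z w, ‖z - w‖ < δ → ‖F z - F w‖ ≤ ε := by
    intro z w hzw
    rw [← dist_eq_norm] at hzw ⊢
    exact (hδ hzw).le
  set κ : ℝ := min (δ / 2) (η / (2 * (5 * π * M + 1))) with hκ
  have hκ0 : 0 < κ := by positivity
  obtain ⟨N, hN⟩ := exists_nat_gt (π / κ)
  refine ⟨N, fun n hn => ?_⟩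
  obtain ⟨m, rfl⟩ : ∃ m, n = m + 1 := ⟨n - 1, by omega⟩
  have hcκ : π / (((m+1:ℕ):ℝ)+1) < κ := by
    rw [div_lt_iff₀ (by positivity)]
    rw [div_lt_iff₀ hκ0] at hN
    have : (N:ℝ) < ((m+1:ℕ):ℝ) := by exact_mod_cast hn
    nlinarith
  have hcδ : 2 * (π / (((m+1:ℕ):ℝ)+1)) < δ := by
    have := min_le_left (δ / 2) (η / (2 * (5 * π * M + 1)))
    linarith
  have hm2 : (((m+1:ℕ):ℝ)+1) = (m:ℝ) + 2 := by push_cast; ring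
  have hT := total_compare m ϑS hϑ F M ε δ hM hδ' (by rw [← hm2]; exact hcδ)
  have hcos : ∀ x y, |x - y| ≤ π / (((m+1:ℕ):ℝ)+1) → 2 * |Real.cos x - Real.cos y| < δ := by
    intro x y hxy
    have := Real.abs_cos_sub_cos_le x y
    linarith
  have hR := riemann_two (fun s t => F ((4 - 2 * Real.cos s - 2 * Real.cos t : ℝ) : ℂ))
    (by unfold Function.uncurry; fun_prop) (m+1) M ε (fun x y => hM _)
    (by
      intro x x' y hx
      apply hδ'
      rw [← Complex.ofReal_sub, Complex.norm_real, Real.norm_eq_abs]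
      have := hcos x x' hx
      rw [show 4 - 2 * Real.cos x - 2 * Real.cos y - (4 - 2 * Real.cos x' - 2 * Real.cos y)
        = -2 * (Real.cos x - Real.cos x') by ring, abs_mul]
      simpa using this)
    (by
      intro y x x' hx
      apply hδ'
      rw [← Complex.ofReal_sub, Complex.norm_real, Real.norm_eq_abs]
      have := hcos x x' hx
      rw [show 4 - 2 * Real.cos y - 2 * Real.cos x - (4 - 2 * Real.cos y - 2 * Real.cos x')
        = -2 * (Real.cos x - Real.cos x') by ring, abs_mul]
      simpa using this)
  set c : ℝ := π / (((m+1:ℕ):ℝ)+1) with hc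
  have hc0 : 0 < c := by positivity
  set S := ((eigs (h2A (m+1) ϑS)).map F).sum
  set W := ∑ i ∈ Finset.range (m+1), ∑ j ∈ Finset.range (m+1),
        F ((4 - 2 * Real.cos (th (m+1) i) - 2 * Real.cos (th (m+1) j) : ℝ) : ℂ)
  set I := ∫ s in (0:ℝ)..π, ∫ t in (0:ℝ)..π, F ((4 - 2 * Real.cos s - 2 * Real.cos t : ℝ) : ℂ)
  rw [dist_eq_norm]
  have e : (c:ℂ)^2 * S - I = (c:ℂ)^2 * (S - W) + ((c:ℂ)^2 * W - I) := by ring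
  rw [e]
  have hA : ‖(c:ℂ)^2 * (S - W)‖ ≤ π^2 * ε + 3 * M * π * c := by
    rw [norm_mul, norm_pow, Complex.norm_real, Real.norm_eq_abs, abs_of_pos hc0]
    have hcm : c * ((m:ℝ)+2) = π := by rw [hc, hm2]; field_simp
    have hcm1 : c * ((m:ℝ)+1) ≤ π := by nlinarith
    have hcm0 : c * (m:ℝ) ≤ π := by nlinarith
    have hmm : 0 ≤ c * (m:ℝ) := by positivity
    have hmm1 : 0 ≤ c * ((m:ℝ)+1) := by positivity
    calc c^2 * ‖S - W‖ ≤ c^2 * ((m+1) * (m * ε + 3 * M)) :=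
          mul_le_mul_of_nonneg_left hT (by positivity)
      _ = (c * (m+1)) * (c * m) * ε + 3 * M * (c * (m+1)) * c := by ring
      _ ≤ π * π * ε + 3 * M * π * c := by gcongr
      _ = _ := by ring
  have hfin : 3 * π^2 * ε = η / 2 := by rw [hε]; field_simp; norm_num
  have hfin2 : 5 * π * M * c < η / 2 := by
    have h5 : c < η / (2 * (5 * π * M + 1)) := lt_of_lt_of_le hcκ (min_le_right _ _)
    have h6 : 0 < 5 * π * M + 1 := by positivity
    rw [lt_div_iff₀ (by positivity)] at h5
    nlinarith
  calc _ ≤ _ := norm_add_le _ _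
    _ ≤ (π^2 * ε + 3 * M * π * c) + (2 * π^2 * ε + 2 * π * M * c) := add_le_add hA hR
    _ = 3 * π^2 * ε + 5 * π * M * c := by ring
    _ < η := by linarith

/-- spectral distribution in 2D: `{h²A_h} ∼_λ 4−2cosθ₁−2cosθ₂`, i.e. for every continuous
compactly supported `F : ℂ → ℂ`, `(1/(n(n+1))) Σᵢ F(λᵢ(h²A_h))` tends to
`(1/(2π)²) ∫_{[−π,π]²} F(4−2cosθ₁−2cosθ₂) dθ₁dθ₂` as `n → ∞`. -/
theorem stmt_17 (ϑS : ℝ) (hϑ : ϑS ∈ Set.Ioo (0:ℝ) 1)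
    (F : ℂ → ℂ) (hF : Continuous F) (hFc : HasCompactSupport F) :
    Tendsto
      (fun n : ℕ => (1 / ((n:ℂ) * ((n:ℂ)+1))) * ((eigs (h2A n ϑS)).map F).sum)
      atTop
      (nhds ((1 / (2*(π:ℂ)))^2 *
        ∫ θ₁ in (-π)..π, ∫ θ₂ in (-π)..π,
          F ((4:ℝ) - 2 * Real.cos θ₁ - 2 * Real.cos θ₂))) := by
  have hmain := scaled_tendsto ϑS hϑ.2 F hF hFc
  set I := ∫ s in (0:ℝ)..π, ∫ t in (0:ℝ)..π, F ((4 - 2 * Real.cos s - 2 * Real.cos t : ℝ) : ℂ)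
    with hI
  have hpi : (π:ℂ) ≠ 0 := by exact_mod_cast Real.pi_ne_zero
  have hG : Continuous (Function.uncurry
      (fun s t : ℝ => F ((4 - 2 * Real.cos s - 2 * Real.cos t : ℝ) : ℂ))) := by
    unfold Function.uncurry; fun_prop
  have hint : (∫ θ₁ in (-π)..π, ∫ θ₂ in (-π)..π,
          F ((4:ℝ) - 2 * Real.cos θ₁ - 2 * Real.cos θ₂)) = 4 * I := by
    have h1 : ∀ s : ℝ, (∫ t in (-π)..π, F ((4:ℝ) - 2 * Real.cos s - 2 * Real.cos t))
        = 2 * ∫ t in (0:ℝ)..π, F ((4 - 2 * Real.cos s - 2 * Real.cos t : ℝ) : ℂ) := by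
      intro s
      rw [← even_integral (fun t => F ((4 - 2 * Real.cos s - 2 * Real.cos t : ℝ) : ℂ))
        (by fun_prop) (by intro x; simp only [Real.cos_neg])]
      push_cast
      rfl
    simp only [h1]
    rw [intervalIntegral.integral_const_mul, even_integral
      (fun s => ∫ t in (0:ℝ)..π, F ((4 - 2 * Real.cos s - 2 * Real.cos t : ℝ) : ℂ))
      (intervalIntegral.continuous_parametric_intervalIntegral_of_continuous' hG 0 π)
      (by intro x; simp only [Real.cos_neg])]
    ring
  rw [hint]
  have hratio : Tendsto (fun n : ℕ => (((n:ℂ) + 1) / (n:ℂ))) atTop (nhds 1) := by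
    have h1 : Tendsto (fun n : ℕ => 1 + (n:ℂ)⁻¹) atTop (nhds (1 + 0)) :=
      tendsto_const_nhds.add tendsto_inv_atTop_nhds_zero_nat
    rw [add_zero] at h1
    refine h1.congr' ?_
    filter_upwards [eventually_gt_atTop 0] with n hn
    have : (n:ℂ) ≠ 0 := by exact_mod_cast hn.ne'
    field_simp
  have hlim := (hmain.mul hratio).const_mul ((1 / (π:ℂ))^2)
  have e : (1 / (2*(π:ℂ)))^2 * (4 * I) = (1 / (π:ℂ))^2 * (I * 1) := by
    field_simp; norm_num
  rw [e]
  refine hlim.congr' ?_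
  filter_upwards [eventually_gt_atTop 0] with n hn
  have h0 : (n:ℂ) ≠ 0 := by exact_mod_cast hn.ne'
  have h1 : (n:ℂ) + 1 ≠ 0 := by exact_mod_cast Nat.succ_ne_zero n
  push_cast
  field_simp
end
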